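/- arXiv:1606.08010 — 4 statements merged into one kernel-verified Lean document; each statement's English description precedes it below -/
import Mathlib

section
/- For all real θ and α, the controlled gate CH(θ,α) := diag(1, 1, H(θ,α)) (the 4 × 4 block-diagonal matrix with blocks I₂ and H(θ,α)) satisfies CH(θ,α) = (I₂ ⊗ A) * CZ * (I₂ ⊗ B), where A = R(α) * R_y(-θ), B = R_y(θ) * R(-α), and CZ = diag(1, 1, 1, -1). -/
open Matrix

/-- Kronecker product of two `2 × 2` complex matrices as a `4 × 4` matrix,
with the row/column index `2*i₁ + i₂` corresponding to the pair `(i₁, i₂)`. -/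
def kron (A B : Matrix (Fin 2) (Fin 2) ℂ) : Matrix (Fin 4) (Fin 4) ℂ :=
  Matrix.of fun i j =>
    A ⟨i.val / 2, by have := i.isLt; omega⟩ ⟨j.val / 2, by have := j.isLt; omega⟩ *
    B ⟨i.val % 2, by omega⟩ ⟨j.val % 2, by omega⟩

/-- The controlled gate `diag(I₂, M)` as a `4 × 4` matrix. -/
def ctrl (M : Matrix (Fin 2) (Fin 2) ℂ) : Matrix (Fin 4) (Fin 4) ℂ :=
  !![1, 0, 0, 0; 0, 1, 0, 0; 0, 0, M 0 0, M 0 1; 0, 0, M 1 0, M 1 1]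

/-- The rotation matrix `R_y(θ)` viewed as a complex `2 × 2` matrix. -/
noncomputable def Ry (θ : ℝ) : Matrix (Fin 2) (Fin 2) ℂ :=
  !![(Real.cos (θ / 2) : ℂ), (Real.sin (θ / 2) : ℂ);
     (-Real.sin (θ / 2) : ℂ), (Real.cos (θ / 2) : ℂ)]

/-- The phase-shift matrix `R(α) = diag(1, e^{iα})`. -/
noncomputable def R (α : ℝ) : Matrix (Fin 2) (Fin 2) ℂ :=
  !![1, 0; 0, Complex.exp (α * Complex.I)]

/-- The `2 × 2` matrix `H(θ,α) = [[cos θ, e^{-iα} sin θ], [e^{iα} sin θ, -cos θ]]`. -/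
noncomputable def Hmat (θ α : ℝ) : Matrix (Fin 2) (Fin 2) ℂ :=
  !![(Real.cos θ : ℂ), Complex.exp (-α * Complex.I) * (Real.sin θ : ℂ);
     Complex.exp (α * Complex.I) * (Real.sin θ : ℂ), (-Real.cos θ : ℂ)]

/-- The controlled-Z gate `CZ = diag(1, 1, 1, -1)`. -/
def CZ : Matrix (Fin 4) (Fin 4) ℂ :=
  !![1, 0, 0, 0; 0, 1, 0, 0; 0, 0, 1, 0; 0, 0, 0, -1]

/-- If `M * N = 1`, conjugating `CZ` by `I₂ ⊗ M` and `I₂ ⊗ N` gives the controlled version of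
the conjugate `M * Z * N` of the Pauli matrix `Z = diag(1, -1)`. -/
theorem kron_one_mul_CZ_mul_kron_one {M N : Matrix (Fin 2) (Fin 2) ℂ} (h : M * N = 1) :
    kron 1 M * CZ * kron 1 N = ctrl (M * !![1, 0; 0, -1] * N) := by
  have h00 := congrFun₂ h 0 0
  have h01 := congrFun₂ h 0 1
  have h10 := congrFun₂ h 1 0
  have h11 := congrFun₂ h 1 1
  simp only [Matrix.mul_apply, Fin.sum_univ_two, Matrix.one_apply] at h00 h01 h10 h11
  ext i j
  fin_cases i <;> fin_cases j <;>
    simp [kron, CZ, ctrl, Matrix.mul_apply, Fin.sum_univ_four, Fin.sum_univ_two,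
      Matrix.one_apply] <;>
    simp_all

theorem Ry_neg_mul_Ry (θ : ℝ) : Ry (-θ) * Ry θ = 1 := by
  have h := Complex.sin_sq_add_cos_sq ((θ : ℂ) / 2)
  ext i j
  fin_cases i <;> fin_cases j <;>
    simp [Ry, neg_div, Matrix.mul_apply, Fin.sum_univ_two] <;> grind

theorem R_mul_R_neg (α : ℝ) : R α * R (-α) = 1 := by
  ext i j
  fin_cases i <;> fin_cases j <;> simp [R, Matrix.mul_apply, Fin.sum_univ_two, ← Complex.exp_add]

theorem Hmat_eq (θ α : ℝ) :
    R α * Ry (-θ) * !![1, 0; 0, -1] * (Ry θ * R (-α)) = Hmat θ α := by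
  have hsq := Complex.sin_sq_add_cos_sq ((θ : ℂ) / 2)
  have hc : Complex.cos θ = 2 * Complex.cos (θ / 2) ^ 2 - 1 := by
    rw [← Complex.cos_two_mul, mul_div_cancel₀ _ two_ne_zero]
  have hs : Complex.sin θ = 2 * Complex.sin (θ / 2) * Complex.cos (θ / 2) := by
    rw [← Complex.sin_two_mul, mul_div_cancel₀ _ two_ne_zero]
  have he : Complex.exp (α * Complex.I) * Complex.exp (-(α * Complex.I)) = 1 := by
    simp [← Complex.exp_add]
  ext i j
  fin_cases i <;> fin_cases j <;>
    simp [R, Ry, Hmat, neg_div, Matrix.mul_apply, Fin.sum_univ_two, hc, hs] <;> grind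

/-- `CH(θ,α) = (I₂ ⊗ A) * CZ * (I₂ ⊗ B)` with `A = R(α) R_y(-θ)` and `B = R_y(θ) R(-α)`. -/
theorem ctrlH_eq_JBHS (θ α : ℝ) :
    ctrl (Hmat θ α) =
      kron 1 (R α * Ry (-θ)) * CZ * kron 1 (Ry θ * R (-α)) := by
  rw [kron_one_mul_CZ_mul_kron_one, Hmat_eq]
  rw [Matrix.mul_assoc, ← Matrix.mul_assoc (Ry (-θ)), Ry_neg_mul_Ry, Matrix.one_mul, R_mul_R_neg]
end

section
/- For all real θ and α, the controlled gate CH(θ,α) := diag(1, 1, H(θ,α)) satisfies CH(θ,α) = (I₂ ⊗ P) * CNOT * (I₂ ⊗ Q), where P = R_z(α) * R_y(-θ + π/2), Q = R_y(θ - π/2) * R_z(-α), and CNOT is the 4 × 4 matrix that fixes the first two basis vectors and swaps the last two. -/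
open Matrix

/-- The CNOT gate: it fixes the first two basis vectors and swaps the last two. -/
def CNOT : Matrix (Fin 4) (Fin 4) ℂ :=
  !![1, 0, 0, 0; 0, 1, 0, 0; 0, 0, 0, 1; 0, 0, 1, 0]

/-- The rotation matrix `R_z(θ) = diag(e^{-iθ/2}, e^{iθ/2})`. -/
noncomputable def Rz (θ : ℝ) : Matrix (Fin 2) (Fin 2) ℂ :=
  !![Complex.exp (-(θ / 2 : ℝ) * Complex.I), 0; 0, Complex.exp ((θ / 2 : ℝ) * Complex.I)]

theorem Ry_zero : Ry 0 = 1 := by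
  simp [Ry, Matrix.one_fin_two]

theorem Rz_zero : Rz 0 = 1 := by
  simp [Rz, Matrix.one_fin_two]

theorem Ry_mul_Ry (a b : ℝ) : Ry a * Ry b = Ry (a + b) := by
  ext i j
  fin_cases i <;> fin_cases j <;>
    simp [Ry, Matrix.mul_apply, Fin.sum_univ_two, add_div, Complex.cos_add, Complex.sin_add] <;>
    ring

theorem Rz_mul_Rz (a b : ℝ) : Rz a * Rz b = Rz (a + b) := by
  ext i j
  fin_cases i <;> fin_cases j <;>
    simp [Rz, Matrix.mul_apply, Fin.sum_univ_two, ← Complex.exp_add] <;>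
    ring_nf

/-- Conjugating the swap matrix by `R_y(a)` gives the reflection 
`[[sin a, cos a], [cos a, -sin a]]`. -/
theorem Ry_mul_swap_mul_Ry_neg (a : ℝ) :
    Ry a * !![0, 1; 1, 0] * Ry (-a) =
      !![(Real.sin a : ℂ), (Real.cos a : ℂ); (Real.cos a : ℂ), (-Real.sin a : ℂ)] := by
  have hc : Complex.cos a = Complex.cos (a / 2) ^ 2 - Complex.sin (a / 2) ^ 2 := by
    rw [← Complex.cos_two_mul', mul_div_cancel₀ _ two_ne_zero]
  have hs : Complex.sin a = 2 * Complex.sin (a / 2) * Complex.cos (a / 2) := by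
    rw [← Complex.sin_two_mul, mul_div_cancel₀ _ two_ne_zero]
  ext i j
  fin_cases i <;> fin_cases j <;>
    simp [Ry, Matrix.mul_apply, Fin.sum_univ_two, neg_div, hc, hs] <;>
    ring

/-- Conjugating by `R_z(α)` multiplies the off-diagonal entries by `e^{∓iα}`. -/
theorem Rz_mul_mul_Rz_neg (α : ℝ) (a b c d : ℂ) :
    Rz α * !![a, b; c, d] * Rz (-α) =
      !![a, Complex.exp (-α * Complex.I) * b; Complex.exp (α * Complex.I) * c, d] := by
  have hp : Complex.exp (α * Complex.I) = Complex.exp (α / 2 * Complex.I) ^ 2 := by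
    rw [← Complex.exp_nat_mul]; congr 1; push_cast; ring
  have hm : Complex.exp (-(α * Complex.I)) = Complex.exp (-(α / 2 * Complex.I)) ^ 2 := by
    rw [← Complex.exp_nat_mul]; congr 1; push_cast; ring
  have h1 : Complex.exp (α / 2 * Complex.I) * Complex.exp (-(α / 2 * Complex.I)) = 1 := by
    rw [← Complex.exp_add, add_neg_cancel, Complex.exp_zero]
  ext i j
  fin_cases i <;> fin_cases j <;>
    simp [Rz, Matrix.mul_apply, Fin.sum_univ_two, neg_div, hp, hm]
  · linear_combination a * h1
  · ring
  · ring
  · linear_combination d * h1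

/-- Multiplying CNOT by gates on the target qubit gives a controlled gate as soon as these gates
are inverse to each other. -/
theorem kron_one_mul_CNOT_mul_kron_one {P Q : Matrix (Fin 2) (Fin 2) ℂ} (h : P * Q = 1) :
    kron 1 P * CNOT * kron 1 Q = ctrl (P * !![0, 1; 1, 0] * Q) := by
  have h00 := congrFun₂ h 0 0
  have h01 := congrFun₂ h 0 1
  have h10 := congrFun₂ h 1 0
  have h11 := congrFun₂ h 1 1
  simp [Matrix.mul_apply, Fin.sum_univ_two] at h00 h01 h10 h11
  ext i j
  fin_cases i <;> fin_cases j <;>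
    simp [kron, CNOT, ctrl, Matrix.mul_apply, Fin.sum_univ_two, Fin.sum_univ_four,
      Matrix.one_fin_two, h00, h01, h10, h11]

/-- `CH(θ,α) = (I₂ ⊗ P) * CNOT * (I₂ ⊗ Q)` with `P = R_z(α) R_y(-θ + π/2)` and
`Q = R_y(θ - π/2) R_z(-α)`. -/
theorem ctrlH_eq_Barenco (θ α : ℝ) :
    ctrl (Hmat θ α) =
      kron 1 (Rz α * Ry (-θ + Real.pi / 2)) * CNOT * kron 1 (Ry (θ - Real.pi / 2) * Rz (-α)) := by
  have hab : θ - Real.pi / 2 = -(-θ + Real.pi / 2) := by ring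
  have hPQ : Rz α * Ry (-θ + Real.pi / 2) * (Ry (θ - Real.pi / 2) * Rz (-α)) = 1 := by
    rw [Matrix.mul_assoc, ← Matrix.mul_assoc (Ry _), Ry_mul_Ry, hab, add_neg_cancel, Ry_zero,
      Matrix.one_mul, Rz_mul_Rz, add_neg_cancel, Rz_zero]
  have hM : Rz α * Ry (-θ + Real.pi / 2) * !![0, 1; 1, 0] * (Ry (θ - Real.pi / 2) * Rz (-α)) =
      Rz α * (Ry (-θ + Real.pi / 2) * !![0, 1; 1, 0] * Ry (-(-θ + Real.pi / 2))) * Rz (-α) := by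
    rw [hab]
    simp only [Matrix.mul_assoc]
  rw [kron_one_mul_CNOT_mul_kron_one hPQ, hM, Ry_mul_swap_mul_Ry_neg, Rz_mul_mul_Rz_neg,
    Real.sin_add_pi_div_two, Real.cos_add_pi_div_two, Real.cos_neg, Real.sin_neg, neg_neg, Hmat]
end

section
/- For all real θ and α, the controlled gate CH(θ,α) := diag(1, 1, H(θ,α)) satisfies CH(θ,α) = (I₂ ⊗ V) * D * (I₂ ⊗ W), where V = R(α) * R_y(-θ), W = S * R_y(θ) * R(-α) * H(θ,α), and D is the 4 × 4 block-diagonal matrix diag(S, Sᴴ) with S = diag(1, i). -/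
open Matrix

/-- The phase gate `S = diag(1, i)`. -/
def S : Matrix (Fin 2) (Fin 2) ℂ := !![1, 0; 0, Complex.I]

/-- The `4 × 4` block-diagonal matrix `D = diag(S, Sᴴ)`. -/
def Dmat : Matrix (Fin 4) (Fin 4) ℂ :=
  !![1, 0, 0, 0; 0, Complex.I, 0, 0; 0, 0, 1, 0; 0, 0, 0, -Complex.I]

/-- A product `(1 ⊗ V) * diag(S, Sᴴ) * (1 ⊗ W)` is block diagonal with blocks `V S W`
and `V Sᴴ W`. -/
theorem kron_one_mul_Dmat_mul_kron_one {V W M : Matrix (Fin 2) (Fin 2) ℂ}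
    (h₁ : V * S * W = 1) (h₂ : V * Sᴴ * W = M) :
    kron 1 V * Dmat * kron 1 W = ctrl M := by
  subst h₂
  have h00 := congrFun (congrFun h₁ 0) 0
  have h01 := congrFun (congrFun h₁ 0) 1
  have h10 := congrFun (congrFun h₁ 1) 0
  have h11 := congrFun (congrFun h₁ 1) 1
  simp [S, Matrix.mul_apply, Fin.sum_univ_two] at h00 h01 h10 h11
  ext i j
  fin_cases i <;> fin_cases j <;>
    simp [kron, Dmat, ctrl, S, Matrix.mul_apply, Fin.sum_univ_four, Fin.sum_univ_two,
      Matrix.one_apply, h00, h01, h10, h11]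

theorem S_mul_S : S * S = !![1, 0; 0, -1] := by
  simp [S]

theorem conjTranspose_S_mul_S : Sᴴ * S = 1 := by
  ext i j
  fin_cases i <;> fin_cases j <;> simp [S, Matrix.mul_apply]

theorem Ry_neg_mul_Z_mul_Ry (θ : ℝ) :
    Ry (-θ) * !![1, 0; 0, -1] * Ry θ =
      !![(Real.cos θ : ℂ), (Real.sin θ : ℂ); (Real.sin θ : ℂ), (-Real.cos θ : ℂ)] := by
  have h : (Complex.cos (θ / 2)) ^ 2 + (Complex.sin (θ / 2)) ^ 2 = 1 :=
    Complex.cos_sq_add_sin_sq _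
  have hc : Complex.cos θ = 2 * Complex.cos (θ / 2) ^ 2 - 1 := by
    rw [← Complex.cos_two_mul]; congr 1; ring
  have hs : Complex.sin θ = 2 * Complex.sin (θ / 2) * Complex.cos (θ / 2) := by
    rw [← Complex.sin_two_mul]; congr 1; ring
  ext i j
  fin_cases i <;> fin_cases j <;> simp [Ry, neg_div, Matrix.mul_apply] <;> grind

theorem R_mul_mul_R_neg (θ α : ℝ) :
    R α * !![(Real.cos θ : ℂ), (Real.sin θ : ℂ); (Real.sin θ : ℂ), (-Real.cos θ : ℂ)] *
      R (-α) = Hmat θ α := by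
  have h : Complex.exp (α * Complex.I) * Complex.exp (-(α * Complex.I)) = 1 := by
    simp [← Complex.exp_add]
  ext i j
  fin_cases i <;> fin_cases j <;> simp [R, Hmat, Matrix.mul_apply] <;> grind

theorem Hmat_mul_self (θ α : ℝ) : Hmat θ α * Hmat θ α = 1 := by
  have h : Complex.exp (α * Complex.I) * Complex.exp (-(α * Complex.I)) = 1 := by
    simp [← Complex.exp_add]
  have hcs : (Complex.cos θ) ^ 2 + (Complex.sin θ) ^ 2 = 1 := Complex.cos_sq_add_sin_sq _
  ext i j
  fin_cases i <;> fin_cases j <;> simp [Hmat, Matrix.mul_apply] <;> grind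

/-- `CH(θ,α) = (I₂ ⊗ V) * D * (I₂ ⊗ W)` with `V = R(α) R_y(-θ)`,
`W = S R_y(θ) R(-α) H(θ,α)` and `D = diag(S, Sᴴ)`. -/
theorem ctrlH_eq_QSD (θ α : ℝ) :
    ctrl (Hmat θ α) =
      kron 1 (R α * Ry (-θ)) * Dmat * kron 1 (S * Ry θ * R (-α) * Hmat θ α) := by
  refine (kron_one_mul_Dmat_mul_kron_one ?_ ?_).symm
  · calc R α * Ry (-θ) * S * (S * Ry θ * R (-α) * Hmat θ α)
        = R α * (Ry (-θ) * (S * S) * Ry θ) * R (-α) * Hmat θ α := by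
          simp only [Matrix.mul_assoc]
      _ = 1 := by
          rw [S_mul_S, Ry_neg_mul_Z_mul_Ry, R_mul_mul_R_neg, Hmat_mul_self]
  · calc R α * Ry (-θ) * Sᴴ * (S * Ry θ * R (-α) * Hmat θ α)
        = R α * (Ry (-θ) * (Sᴴ * S) * Ry θ) * R (-α) * Hmat θ α := by
          simp only [Matrix.mul_assoc]
      _ = Hmat θ α := by
          rw [conjTranspose_S_mul_S, Matrix.mul_one, Ry_neg_mul_Ry, Matrix.mul_one,
            R_mul_R_neg, Matrix.one_mul]
end

section
/- For every n ≥ 1 and all real θ, α, the multiple-control gate C^{n-1}H(θ,α) := diag(I_{2^n - 2}, H(θ,α)) (the 2^n × 2^n block-diagonal matrix acting as the identity on the first 2^n - 2 basis states and as H(θ,α) on the last two) satisfies C^{n-1}H(θ,α) = (I_{2^{n-1}} ⊗ A) * diag(I_{2^n - 2}, Z) * (I_{2^{n-1}} ⊗ B), where A = R(α) * R_y(-θ) and B = R_y(θ) * R(-α). -/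
open Matrix

/-- The `2^n × 2^n` block-diagonal matrix `diag(I_{2^n - 2}, M)`: it acts as the identity on
the first `2^n - 2` basis states and as the `2 × 2` matrix `M` on the last two. -/
noncomputable def ctrlPow (n : ℕ) (M : Matrix (Fin 2) (Fin 2) ℂ) :
    Matrix (Fin (2 ^ n)) (Fin (2 ^ n)) ℂ :=
  Matrix.of fun i j =>
    if h : 2 ^ n - 2 ≤ i.val ∧ 2 ^ n - 2 ≤ j.val then
      M ⟨i.val - (2 ^ n - 2), by have := i.isLt; omega⟩
        ⟨j.val - (2 ^ n - 2), by have := j.isLt; omega⟩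
    else if i = j then 1 else 0

/-- The Kronecker product `I_{2^{n-1}} ⊗ A` as a `2^n × 2^n` matrix (for `n ≥ 1`): the basis
index `2*r + s` corresponds to the pair `(r, s)`, and the entry at `((r,s),(r',s'))` is
`δ_{r r'} · A s s'`. -/
noncomputable def idKron (n : ℕ) (A : Matrix (Fin 2) (Fin 2) ℂ) :
    Matrix (Fin (2 ^ n)) (Fin (2 ^ n)) ℂ :=
  Matrix.of fun i j =>
    if i.val / 2 = j.val / 2 then
      A ⟨i.val % 2, by omega⟩ ⟨j.val % 2, by omega⟩
    else 0

/-- The Pauli matrix `Z = diag(1, -1)`. -/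
def Zmat : Matrix (Fin 2) (Fin 2) ℂ := !![1, 0; 0, -1]

/-- The equivalence `i ↦ (i % 2, i / 2)` splitting a basis index into the target qubit and the
control register. -/
def qubitSplit (m : ℕ) : Fin (2 ^ (m + 1)) ≃ Fin 2 × Fin (2 ^ m) :=
  (finCongr (pow_succ 2 m)).trans (finProdFinEquiv.symm.trans (Equiv.prodComm _ _))

theorem idKron_eq_submatrix_blockDiagonal (m : ℕ) (A : Matrix (Fin 2) (Fin 2) ℂ) :
    idKron (m + 1) A =
      (blockDiagonal fun _ : Fin (2 ^ m) => A).submatrix (qubitSplit m) (qubitSplit m) := by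
  ext i j
  simp [idKron, qubitSplit, blockDiagonal_apply, Fin.ext_iff, Fin.divNat, Fin.modNat]

theorem ctrlPow_eq_submatrix_blockDiagonal (m : ℕ) (M : Matrix (Fin 2) (Fin 2) ℂ) :
    ctrlPow (m + 1) M =
      (blockDiagonal fun k : Fin (2 ^ m) => if k.val = 2 ^ m - 1 then M else 1).submatrix
        (qubitSplit m) (qubitSplit m) := by
  ext i j
  obtain ⟨i, hi⟩ := i
  obtain ⟨j, hj⟩ := j
  have hm : 0 < 2 ^ m := by positivity
  have hs : 2 ^ (m + 1) = 2 ^ m * 2 := pow_succ 2 m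
  simp only [ctrlPow, qubitSplit, blockDiagonal_apply, of_apply, submatrix_apply,
    Equiv.trans_apply, finCongr_apply, Fin.cast_mk, finProdFinEquiv_symm_apply,
    Equiv.prodComm_apply, Prod.swap_prod_mk, Fin.divNat, Fin.modNat, Fin.mk.injEq]
  by_cases h : 2 ^ (m + 1) - 2 ≤ i ∧ 2 ^ (m + 1) - 2 ≤ j
  · have hij : i / 2 = j / 2 := by omega
    have hlast : i / 2 = 2 ^ m - 1 := by omega
    rw [dif_pos h, if_pos hij, if_pos hlast]
    congr 2 <;> omega
  · rw [dif_neg h]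
    by_cases hij : i / 2 = j / 2
    · have hlast : i / 2 ≠ 2 ^ m - 1 := by omega
      rw [if_pos hij, if_neg hlast, one_apply]
      simp only [Fin.mk.injEq]
      exact if_congr (by omega) rfl rfl
    · rw [if_neg hij, if_neg (by omega)]

/-- Conjugating a controlled gate on the target qubit by mutually inverse matrices conjugates
the gate being controlled. -/
theorem idKron_mul_ctrlPow_mul_idKron {n : ℕ} (hn : 1 ≤ n) {A B : Matrix (Fin 2) (Fin 2) ℂ}
    (hAB : A * B = 1) (M : Matrix (Fin 2) (Fin 2) ℂ) :
    idKron n A * ctrlPow n M * idKron n B = ctrlPow n (A * M * B) := by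
  obtain ⟨m, rfl⟩ := Nat.exists_eq_add_of_le' hn
  simp only [idKron_eq_submatrix_blockDiagonal, ctrlPow_eq_submatrix_blockDiagonal,
    submatrix_mul_equiv, ← blockDiagonal_mul]
  congr 2
  funext k
  split_ifs <;> simp [hAB]

theorem Ry_neg_mul_Zmat_mul_Ry (θ : ℝ) : Ry (-θ) * Zmat * Ry θ = Hmat θ 0 := by
  have hc := Complex.cos_two_mul' (θ / 2 : ℂ)
  have hs := Complex.sin_two_mul (θ / 2 : ℂ)
  rw [mul_div_cancel₀ (θ : ℂ) two_ne_zero] at hc hs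
  ext i j
  fin_cases i <;> fin_cases j <;> simp [Ry, Zmat, Hmat, mul_apply, neg_div, hc, hs] <;> ring

theorem R_mul_Hmat_zero_mul_R_neg (θ α : ℝ) : R α * Hmat θ 0 * R (-α) = Hmat θ α := by
  have h : Complex.exp (α * Complex.I) * Complex.exp (-(α * Complex.I)) = 1 := by
    simp [← Complex.exp_add]
  ext i j
  fin_cases i <;> fin_cases j <;> simp [R, Hmat, mul_apply]
  · ring
  · linear_combination Complex.cos θ * h

/-- For every `n ≥ 1`, the multiple-control gate `C^{n-1}H(θ,α) = diag(I_{2^n-2}, H(θ,α))`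
factors as `(I_{2^{n-1}} ⊗ A) * diag(I_{2^n-2}, Z) * (I_{2^{n-1}} ⊗ B)` with
`A = R(α) R_y(-θ)` and `B = R_y(θ) R(-α)`. -/
theorem multiControlH_eq_JBHS (n : ℕ) (hn : 1 ≤ n) (θ α : ℝ) :
    ctrlPow n (Hmat θ α) =
      idKron n (R α * Ry (-θ)) * ctrlPow n Zmat * idKron n (Ry θ * R (-α)) := by
  have hAB : R α * Ry (-θ) * (Ry θ * R (-α)) = 1 := by
    rw [Matrix.mul_assoc, ← Matrix.mul_assoc (Ry (-θ)), Ry_neg_mul_Ry, Matrix.one_mul,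
      R_mul_R_neg]
  have hZ : R α * Ry (-θ) * Zmat * (Ry θ * R (-α)) = Hmat θ α := by
    rw [← R_mul_Hmat_zero_mul_R_neg, ← Ry_neg_mul_Zmat_mul_Ry]
    simp only [Matrix.mul_assoc]
  rw [idKron_mul_ctrlPow_mul_idKron hn hAB, hZ]
end
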